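/- Let K be an algebraically closed field and F₁, …, F_m nonconstant polynomials in K[X₁, …, X_n]. Then the number of isolated points of the zero set V(F₁, …, F_m) ⊆ K^n is at most the product deg F₁ · deg F₂ ⋯ deg F_m. -/

import Mathlib

open MvPolynomial

namespace WB

/-- lattice points in the simplex, with weights -/
def smplx (n : ℕ) (e : Fin n → ℕ) (M : ℕ) : Finset (Fin n → ℕ) :=
  (Fintype.piFinset fun _ => Finset.range (M + 1)).filter fun a => ∑ i, a i * e i ≤ M

lemma mem_smplx {n : ℕ} {e : Fin n → ℕ} (he : ∀ i, 0 < e i) {M : ℕ} {a : Fin n → ℕ} :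
    a ∈ smplx n e M ↔ ∑ i, a i * e i ≤ M := by
  simp only [smplx, Finset.mem_filter, Fintype.mem_piFinset, Finset.mem_range, and_iff_right_iff_imp]
  intro h i
  have h1 : a i * e i ≤ ∑ i, a i * e i :=
    Finset.single_le_sum (f := fun i => a i * e i) (fun _ _ => Nat.zero_le _) (Finset.mem_univ i)
  have h2 : a i * 1 ≤ a i * e i := Nat.mul_le_mul_left _ (he i)
  omega

lemma card_smplx_le (n M : ℕ) (e : Fin n → ℕ) : (smplx n e M).card ≤ (M + 1) ^ n := by
  refine (Finset.card_filter_le _ _).trans ?_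
  simp

lemma card_smplx_le_mul {n : ℕ} {e : Fin n → ℕ} (he : ∀ i, 0 < e i) (M : ℕ) :
    (smplx n (fun _ => 1) M).card ≤ (∏ i, e i) * (smplx n e M).card := by
  have h : ((Fintype.piFinset fun i => Finset.range (e i)) ×ˢ smplx n e M).card
      = (∏ i, e i) * (smplx n e M).card := by simp
  rw [← h]
  refine Finset.card_le_card_of_injOn (fun b => (fun i => b i % e i, fun i => b i / e i)) ?_ ?_
  · intro b hb
    have hb' := (mem_smplx (fun _ => Nat.one_pos)).1 hb
    simp only [Finset.coe_product, Set.mem_prod, Finset.mem_coe, Fintype.mem_piFinset,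
      Finset.mem_range]
    refine ⟨fun i => Nat.mod_lt _ (he i), (mem_smplx he).2 (le_trans ?_ hb')⟩
    exact Finset.sum_le_sum fun i _ => by simpa using Nat.div_mul_le_self _ _
  · intro b _ b' _ hbb
    simp only [Prod.mk.injEq] at hbb
    funext i
    rw [← Nat.mod_add_div (b i) (e i), ← Nat.mod_add_div (b' i) (e i), congrFun hbb.1 i,
      congrFun hbb.2 i]

lemma growth (n D : ℕ) (f : ℕ → ℕ) (h0 : 1 ≤ f 0) (hf : ∀ M, f M ≤ (M + 1) ^ n) (hD : 0 < D) :
    ∃ M, D * f (M + D) < (D + 1) * f M := by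
  by_contra! hc
  have h1 : ∀ k, (D + 1) ^ k ≤ D ^ k * f (k * D) := by
    intro k
    induction k with
    | zero => simpa using h0
    | succ k ih =>
      calc (D + 1) ^ (k + 1) = (D + 1) * (D + 1) ^ k := by ring
        _ ≤ (D + 1) * (D ^ k * f (k * D)) := Nat.mul_le_mul_left _ ih
        _ = D ^ k * ((D + 1) * f (k * D)) := by ring
        _ ≤ D ^ k * (D * f (k * D + D)) := Nat.mul_le_mul_left _ (hc _)
        _ = D ^ (k + 1) * f ((k + 1) * D) := by ring_nf
  have hDr : (0 : ℝ) < D := by exact_mod_cast hD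
  have hr : 1 < ((D : ℝ) + 1) / D := by rw [one_lt_div hDr]; linarith
  have ht := (tendsto_pow_const_div_const_pow_of_one_lt n hr).const_mul (((D : ℝ) + 1) ^ n)
  rw [mul_zero] at ht
  obtain ⟨k, hk1, hk⟩ :=
    ((ht.eventually_lt_const one_pos).and (Filter.eventually_ge_atTop 1)).exists
  have h2 : ((D : ℝ) + 1) ^ k ≤ D ^ k * ((D + 1) ^ n * k ^ n) := by
    have h3 : (D + 1) ^ k ≤ D ^ k * ((D + 1) ^ n * k ^ n) := by
      refine (h1 k).trans (Nat.mul_le_mul_left _ ((hf _).trans ?_))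
      rw [← mul_pow]
      exact Nat.pow_le_pow_left (by nlinarith) _
    exact_mod_cast h3
  have h4 : (0 : ℝ) < (((D : ℝ) + 1) / D) ^ k := by positivity
  rw [← mul_div_assoc, div_lt_one h4, div_pow, lt_div_iff₀ (by positivity)] at hk1
  nlinarith

lemma exists_rel {K : Type*} [Field K] (n : ℕ) (G : Fin n → MvPolynomial (Fin n) K)
    (e : Fin n → ℕ) (he : ∀ i, 0 < e i) (hG : ∀ i, (G i).totalDegree ≤ e i)
    (L : MvPolynomial (Fin n) K) (hL : L.totalDegree ≤ 1) :
    ∃ P : Fin ((∏ i, e i) + 1) → MvPolynomial (Fin n) K, P ≠ 0 ∧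
      ∑ j, aeval G (P j) * L ^ (j : ℕ) = 0 := by
  classical
  set D := ∏ i, e i with hDdef
  have hD : 0 < D := Finset.prod_pos fun i _ => he i
  obtain ⟨M, hM⟩ := growth n D (fun M => (smplx n (fun _ => 1) M).card)
    (Finset.card_pos.2 ⟨0, (mem_smplx fun _ => Nat.one_pos).2 (by simp)⟩)
    (fun M => card_smplx_le n M _) hD
  have hlt : (smplx n (fun _ => 1) (M + D)).card < (D + 1) * (smplx n e M).card := by
    have h1 := card_smplx_le_mul he M
    rw [← hDdef] at h1
    have h2 : D * (smplx n (fun _ => 1) (M + D)).card < D * ((D + 1) * (smplx n e M).card) :=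
      calc _ < _ := hM
        _ ≤ (D + 1) * (D * (smplx n e M).card) := Nat.mul_le_mul_left _ h1
        _ = _ := by ring
    exact Nat.lt_of_mul_lt_mul_left h2
  let fs : (Fin n → ℕ) → (Fin n →₀ ℕ) := fun a => Finsupp.equivFunOnFinite.symm a
  let v : (smplx n e M) × Fin (D + 1) → MvPolynomial (Fin n) K := fun t =>
    aeval G (monomial (fs t.1) (1 : K)) * L ^ (t.2 : ℕ)
  have hv : ∀ t, (v t).totalDegree ≤ M + D := by
    rintro ⟨⟨a, ha⟩, j⟩
    have ha' := (mem_smplx he).1 ha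
    refine (totalDegree_mul _ _).trans (add_le_add ?_ ?_)
    · rw [aeval_monomial, map_one, one_mul, Finsupp.prod_fintype _ _ (by simp)]
      refine (totalDegree_finsetProd _ _).trans (le_trans ?_ ha')
      refine Finset.sum_le_sum fun i _ => (totalDegree_pow _ _).trans ?_
      exact Nat.mul_le_mul_left _ (hG i)
    · refine (totalDegree_pow _ _).trans ?_
      have := j.2
      calc (j : ℕ) * L.totalDegree ≤ j * 1 := Nat.mul_le_mul_left _ hL
        _ ≤ D := by omega
  let Φ : ((smplx n e M) × Fin (D + 1) → K) →ₗ[K] ((smplx n (fun _ => 1) (M + D)) → K) :=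
    LinearMap.pi fun b => (lcoeff K (fs b)) ∘ₗ (Fintype.linearCombination K v)
  have hker : LinearMap.ker Φ ≠ ⊥ := by
    apply LinearMap.ker_ne_bot_of_finrank_lt
    simp only [Module.finrank_fintype_fun_eq_card, Fintype.card_prod, Fintype.card_coe,
      Fintype.card_fin]
    linarith
  obtain ⟨w, hw, hw0⟩ := (Submodule.ne_bot_iff _).1 hker
  refine ⟨fun j => ∑ a : smplx n e M, monomial (fs a) (w (a, j)), ?_, ?_⟩
  · intro h
    apply hw0
    funext ⟨a, j⟩
    have h1 := congrArg (coeff (fs a)) (congrFun h j)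
    rw [coeff_sum, Finset.sum_eq_single a] at h1
    · simpa using h1
    · intro b _ hb
      rw [coeff_monomial, if_neg]
      intro hh
      exact hb (Subtype.ext (Finsupp.equivFunOnFinite.symm.injective hh))
    · simp
  · have hsum : ∑ j : Fin (D + 1), aeval G (∑ a : smplx n e M, monomial (fs a) (w (a, j))) * L ^ (j : ℕ)
        = ∑ t, w t • v t := by
      rw [Fintype.sum_prod_type_right]
      refine Finset.sum_congr rfl fun j _ => ?_
      rw [map_sum, Finset.sum_mul]
      refine Finset.sum_congr rfl fun a _ => ?_
      have : monomial (fs a) (w (a, j)) = w (a, j) • monomial (fs a) (1 : K) := by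
        rw [smul_monomial, smul_eq_mul, mul_one]
      rw [this, map_smul, smul_mul_assoc]
    rw [hsum]
    have hdeg : (∑ t, w t • v t).totalDegree ≤ M + D :=
      totalDegree_finsetSum_le fun t _ => (totalDegree_smul_le _ _).trans (hv t)
    ext b
    rw [coeff_zero]
    by_cases hb : ∑ i, b i ≤ M + D
    · have hb' : (b : Fin n → ℕ) ∈ smplx n (fun _ => 1) (M + D) :=
        (mem_smplx fun _ => Nat.one_pos).2 (by simpa using hb)
      have := congrFun (LinearMap.mem_ker.1 hw) ⟨b, hb'⟩
      simp only [Φ, LinearMap.pi_apply, LinearMap.comp_apply, Fintype.linearCombination_apply,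
        lcoeff_apply, Pi.zero_apply] at this
      have hfs : fs b = b := by ext; rfl
      rwa [hfs] at this
    · apply coeff_eq_zero_of_totalDegree_lt
      have : b.support.sum b = ∑ i, b i := by
        refine Finset.sum_subset (Finset.subset_univ _) ?_
        intro i _ hi; simpa using hi
      change _ < b.support.sum b
      omega


/-- the maximal ideal of a point -/
noncomputable def mI {K : Type*} [Field K] {n : ℕ} (x : Fin n → K) : Ideal (MvPolynomial (Fin n) K) :=
  RingHom.ker (eval x)

lemma mem_mI {K : Type*} [Field K] {n : ℕ} {x : Fin n → K} {p : MvPolynomial (Fin n) K} :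
    p ∈ mI x ↔ eval x p = 0 := RingHom.mem_ker

instance {K : Type*} [Field K] {n : ℕ} (x : Fin n → K) : (mI x).IsPrime :=
  RingHom.ker_isPrime _

/-- translation -/
noncomputable def translate {K : Type*} [Field K] {n : ℕ} (c : Fin n → K) :
    MvPolynomial (Fin n) K ≃ₐ[K] MvPolynomial (Fin n) K :=
  AlgEquiv.ofAlgHom (aeval fun i => X i + C (c i)) (aeval fun i => X i - C (c i))
    (by ext i; simp [← algebraMap_eq]) (by ext i; simp [← algebraMap_eq])

lemma eval_trans {K : Type*} [Field K] {n : ℕ} (c x : Fin n → K) (p : MvPolynomial (Fin n) K) :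
    eval x (translate c p) = eval (x + c) p := by
  have : ((aeval x).comp (translate c : MvPolynomial (Fin n) K →ₐ[K] MvPolynomial (Fin n) K))
      = (aeval (x + c) : MvPolynomial (Fin n) K →ₐ[K] K) := by
    ext i; simp [translate]
  exact DFunLike.congr_fun this p

lemma height_mI {K : Type*} [Field K] [IsAlgClosed K] {n : ℕ} (x : Fin n → K) :
    (mI x).height = n := by
  have hdim : ringKrullDim (MvPolynomial (Fin n) K) = n := by
    rw [MvPolynomial.ringKrullDim_of_isNoetherianRing]
    simp
  have : FiniteRingKrullDim (MvPolynomial (Fin n) K) := by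
    rw [finiteRingKrullDim_iff_ne_bot_and_top, hdim]
    exact ⟨WithBot.coe_ne_bot, fun h => ENat.natCast_ne_top n (WithBot.coe_injective h)⟩
  obtain ⟨p, hp, hh⟩ := Ideal.exists_isMaximal_height (R := MvPolynomial (Fin n) K)
  obtain ⟨y, rfl⟩ := isMaximal_iff_eq_vanishingIdeal_singleton.1 hp
  rw [hdim] at hh
  have hy : (vanishingIdeal K {y} : Ideal (MvPolynomial (Fin n) K)) = mI y := by
    ext p
    rw [mem_vanishingIdeal_singleton_iff, mem_mI]; rfl
  rw [hy] at hh
  have h2 : Ideal.comap (translate (x - y)).toRingEquiv (mI y) = mI x := by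
    ext p
    rw [Ideal.mem_comap, mem_mI, mem_mI]
    have := eval_trans (x - y) y p
    rw [add_sub_cancel] at this
    rw [← this]; rfl
  rw [← h2, RingEquiv.height_comap]
  exact_mod_cast hh

lemma isolated_prime {K : Type*} [Field K] [IsAlgClosed K] {n m : ℕ}
    {F : Fin m → MvPolynomial (Fin n) K} {x : Fin n → K} {g : MvPolynomial (Fin n) K}
    (hg : eval x g ≠ 0) (hiso : ∀ y, (∀ i, eval y (F i) = 0) → eval y g ≠ 0 → y = x)
    (p : Ideal (MvPolynomial (Fin n) K)) [hp : p.IsPrime] (hpx : p ≤ mI x) (hF : ∀ i, F i ∈ p) :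
    p = mI x := by
  refine le_antisymm hpx fun q hq => ?_
  have hgp : g ∉ p := fun h => hg (mem_mI.1 (hpx h))
  have h1 : g * q ∈ p := by
    rw [← IsPrime.vanishingIdeal_zeroLocus (K := K) p, mem_vanishingIdeal_iff]
    intro y hy
    have hy' : ∀ i, eval y (F i) = 0 := fun i => (mem_zeroLocus_iff.1 hy) _ (hF i)
    change eval y (g * q) = 0
    rw [map_mul]
    by_cases hgy : eval y g = 0
    · rw [hgy, zero_mul]
    · rw [hiso y hy' hgy, mem_mI.1 hq, mul_zero]
  exact (hp.mem_or_mem h1).resolve_left hgp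

lemma avoid {K : Type*} [Field K] [Infinite K] {E : Type*} [AddCommGroup E] [Module K E]
    {ι : Type*} (s : Set ι) (hs : s.Finite) (W : ι → Submodule K E) (hW : ∀ i ∈ s, W i ≠ ⊤) :
    ∃ c : E, ∀ i ∈ s, c ∉ W i := by
  classical
  have h := Subspace.biUnion_ne_univ_of_top_notMem (k := K) (E := E) (s := hs.toFinset.image W) (by
    simp only [Finset.mem_image, Set.Finite.mem_toFinset, not_exists, not_and]
    exact hW)
  obtain ⟨c, hc⟩ := (Set.ne_univ_iff_exists_notMem _).1 h
  refine ⟨c, fun i hi hci => hc ?_⟩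
  simp only [Set.mem_iUnion]
  exact ⟨W i, Finset.mem_image_of_mem _ (by simpa using hi), hci⟩

lemma exists_sep {K : Type*} [Field K] [Infinite K] {n : ℕ} (S : Finset (Fin n → K)) :
    ∃ L : MvPolynomial (Fin n) K, L.totalDegree ≤ 1 ∧ Set.InjOn (fun x => eval x L) S := by
  classical
  let W : (Fin n → K) × (Fin n → K) → Submodule K (Fin n → K) := fun t =>
    LinearMap.ker (Fintype.linearCombination K (fun i => t.1 i - t.2 i))
  obtain ⟨c, hc⟩ := avoid (S.offDiag : Set _) (S.offDiag.finite_toSet) W (by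
    rintro ⟨x, y⟩ hxy
    simp only [Finset.mem_coe, Finset.mem_offDiag] at hxy
    obtain ⟨i, hi⟩ := Function.ne_iff.1 hxy.2.2
    intro htop
    have : Pi.single i 1 ∈ W (x, y) := htop ▸ Submodule.mem_top
    simp [W, LinearMap.mem_ker, Fintype.linearCombination_apply_single] at this
    exact hi (sub_eq_zero.1 this))
  refine ⟨∑ i, C (c i) * X i, ?_, ?_⟩
  · refine totalDegree_finsetSum_le fun i _ => (totalDegree_mul _ _).trans ?_
    simp
  · intro x hx y hy hxy
    by_contra hne
    apply hc (x, y) (by simpa using ⟨hx, hy, hne⟩)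
    simp only [map_sum, map_mul, eval_C, eval_X] at hxy
    simp only [W, LinearMap.mem_ker, Fintype.linearCombination_apply, smul_eq_mul, mul_sub,
      Finset.sum_sub_distrib, hxy, sub_self]

lemma exists_div {K : Type*} [Field K] {N : ℕ} (p : Fin N → Polynomial K) (hp : p ≠ 0) :
    ∃ (k : ℕ) (q : Fin N → Polynomial K), (∀ j, p j = Polynomial.X ^ k * q j) ∧
      ∃ j, (q j).eval 0 ≠ 0 := by
  classical
  have hex : ∃ d, ∃ j, (p j).coeff d ≠ 0 := by
    obtain ⟨j, hj⟩ := Function.ne_iff.1 hp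
    by_contra! h
    exact hj (Polynomial.ext fun d => by simpa using h d j)
  have h1 : ∀ j, ∃ q, p j = Polynomial.X ^ (Nat.find hex) * q := by
    intro j
    refine Polynomial.X_pow_dvd_iff.2 fun d hd => ?_
    have := Nat.find_min hex hd
    push Not at this
    exact this j
  choose q hq using h1
  refine ⟨_, q, hq, ?_⟩
  obtain ⟨j, hj⟩ := Nat.find_spec hex
  refine ⟨j, ?_⟩
  rw [hq j] at hj
  rw [← Polynomial.coeff_zero_eq_eval_zero]
  simpa [Polynomial.coeff_X_pow_mul'] using hj

lemma square {K : Type*} [Field K] [IsAlgClosed K] (n : ℕ)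
    (G : Fin (n + 1) → MvPolynomial (Fin (n + 1)) K)
    (e : Fin (n + 1) → ℕ) (he : ∀ i, 0 < e i) (hG : ∀ i, (G i).totalDegree ≤ e i)
    (S : Finset (Fin (n + 1) → K)) (hS0 : ∀ x ∈ S, ∀ i, eval x (G i) = 0)
    (hS : ∀ x ∈ S, ∀ p : Ideal (MvPolynomial (Fin (n + 1)) K), p.IsPrime → p ≤ mI x →
      (∀ i, G i ∈ p) → p = mI x) : S.card ≤ ∏ i, e i := by
  classical
  have : Infinite K := IsAlgClosed.instInfinite
  obtain ⟨L, hL, hLS⟩ := exists_sep S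
  obtain ⟨P, hP0, hP⟩ := exists_rel (n + 1) G e he hG L hL
  obtain ⟨j0, hj0⟩ := Function.ne_iff.1 hP0
  have hne : X 0 * P j0 ≠ 0 := mul_ne_zero (X_ne_zero _) hj0
  obtain ⟨c, hc⟩ : ∃ c, eval c (X 0 * P j0) ≠ 0 := by
    by_contra! h
    exact hne (MvPolynomial.funext fun x => by simpa using h x)
  rw [map_mul, eval_X] at hc
  have hc0 := left_ne_zero_of_mul hc
  have hcP := right_ne_zero_of_mul hc
  let pp : Fin ((∏ i, e i) + 1) → Polynomial K := fun j =>
    aeval (fun i => Polynomial.C (c i) * Polynomial.X) (P j)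
  have hpp : pp ≠ 0 := by
    intro h
    have h1 := congrArg (Polynomial.eval 1) (congrFun h j0)
    apply hcP
    have h2 : Polynomial.eval 1 (pp j0) = eval c (P j0) := by
      have : (Polynomial.aeval (1 : K)).comp (aeval (fun i => Polynomial.C (c i) * Polynomial.X))
        = (aeval c : MvPolynomial (Fin (n + 1)) K →ₐ[K] K) := by ext i; simp
      exact DFunLike.congr_fun this (P j0)
    rw [← h2, h1]; simp
  obtain ⟨k, q, hq, j1, hj1⟩ := exists_div pp hpp
  let R : Polynomial K := ∑ j : Fin ((∏ i, e i) + 1), Polynomial.monomial (j : ℕ) ((q j).eval 0)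
  have hR0 : R ≠ 0 := by
    intro h
    apply hj1
    have h1 := congrArg (fun r => Polynomial.coeff r (j1 : ℕ)) h
    simp only [R, Polynomial.finsetSum_coeff, Polynomial.coeff_zero] at h1
    rw [Finset.sum_eq_single j1] at h1
    · simpa using h1
    · intro b _ hb
      rw [Polynomial.coeff_monomial, if_neg (fun h => hb (Fin.ext h))]
    · simp
  have hRdeg : R.natDegree ≤ ∏ i, e i := by
    refine Polynomial.natDegree_sum_le_of_forall_le _ _ fun j _ => ?_
    exact (Polynomial.natDegree_monomial_le _).trans (by have := j.2; omega)
  rw [← Finset.card_image_of_injOn hLS]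
  refine le_trans (Polynomial.card_le_degree_of_subset_roots (p := R) ?_) hRdeg
  intro t ht
  rw [Finset.mem_val, Finset.mem_image] at ht
  obtain ⟨x, hx, rfl⟩ := ht
  rw [Polynomial.mem_roots hR0, Polynomial.IsRoot.def]
  -- the curve
  let s : MvPolynomial (Fin (n + 1)) K := C (c 0)⁻¹ * G 0
  let gen : Fin n → MvPolynomial (Fin (n + 1)) K := fun i => G i.succ - C (c i.succ) * s
  have hsx : eval x s = 0 := by simp [s, hS0 x hx 0]
  have hIle : Ideal.span (Set.range gen) ≤ mI x := by
    rw [Ideal.span_le]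
    rintro _ ⟨i, rfl⟩
    simp [SetLike.mem_coe, mem_mI, gen, hS0 x hx, hsx]
  obtain ⟨p, hp, hpx⟩ := Ideal.exists_minimalPrimes_le hIle
  have hpp' : p.IsPrime := hp.1.1
  have hheight : p.height ≤ n := by
    refine (Ideal.height_le_card_of_mem_minimalPrimes_span (Set.finite_range gen) hp).trans ?_
    have : (Set.range gen).ncard ≤ n := by
      rw [← Set.image_univ]
      refine (Set.ncard_image_le (Set.finite_univ)).trans ?_
      simp [Set.ncard_univ]
    exact_mod_cast this
  have hpne : p ≠ mI x := by
    rintro rfl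
    rw [height_mI] at hheight
    have : n + 1 ≤ n := by exact_mod_cast hheight
    omega
  have hrel : ∀ i, G i - C (c i) * s ∈ p := by
    intro i
    refine Fin.cases ?_ (fun i => ?_) i
    · have : G 0 - C (c 0) * s = 0 := by
        simp only [s]
        rw [← mul_assoc, ← C_mul, mul_inv_cancel₀ hc0, C_1, one_mul, sub_self]
      rw [this]; exact p.zero_mem
    · exact hp.1.2 (Ideal.subset_span ⟨i, rfl⟩)
  have hsp : s ∉ p := by
    intro hs
    apply hpne
    refine hS x hx p hpp' hpx fun i => ?_
    have := p.add_mem (hrel i) (p.mul_mem_left (C (c i)) hs)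
    rwa [sub_add_cancel] at this
  have hmod : ∀ f : MvPolynomial (Fin (n + 1)) K, aeval G f -
      Polynomial.aeval s (aeval (fun i => Polynomial.C (c i) * Polynomial.X) f : Polynomial K) ∈ p := by
    intro f
    rw [← Ideal.Quotient.eq]
    have : (Ideal.Quotient.mkₐ K p).comp (aeval G) =
      (Ideal.Quotient.mkₐ K p).comp ((Polynomial.aeval s).comp
        (aeval (fun i => Polynomial.C (c i) * Polynomial.X) :
          MvPolynomial (Fin (n + 1)) K →ₐ[K] Polynomial K)) := by
      ext i
      simp only [AlgHom.comp_apply, aeval_X, map_mul, Polynomial.aeval_C, Polynomial.aeval_X]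
      rw [← map_mul]
      exact Ideal.Quotient.eq.2 (hrel i)
    exact DFunLike.congr_fun this f
  have hsum : s ^ k * ∑ j, Polynomial.aeval s (q j) * L ^ (j : ℕ) ∈ p := by
    have h1 : s ^ k * ∑ j, Polynomial.aeval s (q j) * L ^ (j : ℕ) =
        ∑ j, Polynomial.aeval s (pp j) * L ^ (j : ℕ) := by
      rw [Finset.mul_sum]
      refine Finset.sum_congr rfl fun j _ => ?_
      rw [hq j, map_mul, map_pow, Polynomial.aeval_X, mul_assoc]
    have h2 : ∑ j, (aeval G (P j) - Polynomial.aeval s (pp j)) * L ^ (j : ℕ) ∈ p :=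
      p.sum_mem fun j _ => p.mul_mem_right _ (hmod (P j))
    simp only [sub_mul, Finset.sum_sub_distrib, hP, zero_sub] at h2
    rw [h1]
    exact neg_mem_iff.1 h2
  have h3 := hpx ((hpp'.mem_or_mem hsum).resolve_left fun h => hsp (hpp'.mem_of_pow_mem k h))
  rw [mem_mI, map_sum] at h3
  rw [Polynomial.eval_finsetSum]
  refine Eq.trans ?_ h3
  refine Finset.sum_congr rfl fun j _ => ?_
  rw [Polynomial.eval_monomial, map_mul, map_pow]
  congr 1
  have h4 : eval x (Polynomial.aeval s (q j)) = Polynomial.eval (eval x s) (q j) := by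
    have : (aeval x : MvPolynomial (Fin (n + 1)) K →ₐ[K] K).comp (Polynomial.aeval s)
      = Polynomial.aeval (eval x s) := by
        ext; simp [aeval_eq_eval]
    exact (DFunLike.congr_fun this (q j)).trans (by simp)
  rw [h4, hsx]

lemma reduce {K : Type*} [Field K] [IsAlgClosed K] {n m : ℕ}
    (F : Fin m → MvPolynomial (Fin n) K) (hF : ∀ i, 0 < (F i).totalDegree)
    (S : Finset (Fin n → K)) (hSne : S.Nonempty) (hS0 : ∀ x ∈ S, ∀ i, eval x (F i) = 0)
    (hS : ∀ x ∈ S, ∀ p : Ideal (MvPolynomial (Fin n) K), p.IsPrime → p ≤ mI x →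
      (∀ i, F i ∈ p) → p = mI x) (k : ℕ) (hk : k ≤ n) :
    ∃ (U : Finset (Fin m)) (G : Fin k → MvPolynomial (Fin n) K) (e : Fin k → ℕ),
      (∀ i, 0 < e i) ∧ (∀ i, (G i).totalDegree ≤ e i) ∧
      (∏ i, e i = ∏ i ∈ U, (F i).totalDegree) ∧
      (∀ x ∈ S, ∀ i, eval x (G i) = 0) ∧
      (∀ p : Ideal (MvPolynomial (Fin n) K), (∀ i, G i ∈ p) → (∀ i ∉ U, F i ∈ p) → ∀ i, F i ∈ p) ∧
      (∀ x ∈ S, ∀ p : Ideal (MvPolynomial (Fin n) K), p.IsPrime → p ≤ mI x →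
        (∀ i, G i ∈ p) → (k : ℕ∞) ≤ p.height) := by
  classical
  have : Infinite K := IsAlgClosed.instInfinite
  induction k with
  | zero =>
    refine ⟨∅, Fin.elim0, Fin.elim0, fun i => i.elim0, fun i => i.elim0, by simp,
      fun _ _ i => i.elim0, fun p _ h i => h i (by simp), ?_⟩
    intros; simp
  | succ k ih =>
    obtain ⟨U, G, e, he, hGe, hprod, hG0, hspan, hht⟩ := ih (by omega)
    let I : Ideal (MvPolynomial (Fin n) K) := Ideal.span (Set.range G)
    have hIx : ∀ x ∈ S, I ≤ mI x := by
      intro x hx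
      rw [Ideal.span_le]
      rintro _ ⟨i, rfl⟩
      exact mem_mI.2 (hG0 x hx i)
    let Ps : Set (Ideal (MvPolynomial (Fin n) K)) := {p | p ∈ I.minimalPrimes ∧ ∃ x ∈ S, p ≤ mI x}
    have hPs : Ps.Finite :=
      (Ideal.finite_minimalPrimes_of_isNoetherianRing _ I).subset fun p hp => hp.1
    have hnot : ∀ p ∈ Ps, ∃ j, j ∉ U ∧ F j ∉ p := by
      rintro p ⟨hp, x, hx, hpx⟩
      by_contra! h
      have h1 := hspan p (fun i => hp.1.2 (Ideal.subset_span ⟨i, rfl⟩)) h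
      have h2 := hS x hx p hp.1.1 hpx h1
      have h3 := Ideal.height_le_card_of_mem_minimalPrimes_span (Set.finite_range G) hp
      have h4 : (Set.range G).ncard ≤ k := by
        rw [← Set.image_univ]
        refine (Set.ncard_image_le (Set.finite_univ)).trans ?_
        simp [Set.ncard_univ]
      rw [h2, height_mI] at h3
      have h5 : n ≤ (Set.range G).ncard := by exact_mod_cast h3
      omega
    obtain ⟨x0, hx0⟩ := hSne
    have hUc : (Finset.univ \ U).Nonempty := by
      obtain ⟨p, hp, hpx⟩ := Ideal.exists_minimalPrimes_le (hIx x0 hx0)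
      obtain ⟨j, hj, -⟩ := hnot p ⟨hp, x0, hx0, hpx⟩
      exact ⟨j, by simpa using hj⟩
    obtain ⟨j0, hj0, hmax⟩ := Finset.exists_max_image _ (fun j => (F j).totalDegree) hUc
    have hj0U : j0 ∉ U := by simpa using hj0
    let Λ : (Fin m → K) →ₗ[K] MvPolynomial (Fin n) K :=
      Fintype.linearCombination K (fun j => if j ∈ U then 0 else F j)
    have hΛ : ∀ j, j ∉ U → Λ (Pi.single j 1) = F j := by
      intro j hj
      simp [Λ, Fintype.linearCombination_apply_single, hj]
    obtain ⟨c1, hc1⟩ := avoid (K := K) (E := Fin m → K)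
      (Set.image Option.some Ps ∪ {none}) ((hPs.image _).union (Set.finite_singleton _))
      (fun o => o.elim (LinearMap.ker (LinearMap.proj (R := K) (φ := fun _ : Fin m => K) j0))
        (fun p => (p.restrictScalars K).comap Λ)) (by
      rintro o (⟨p, hp, rfl⟩ | rfl)
      · obtain ⟨j, hjU, hjp⟩ := hnot p hp
        intro htop
        have : Pi.single j 1 ∈ (p.restrictScalars K).comap Λ := by
          simp only [Option.elim] at htop
          rw [htop]; exact Submodule.mem_top
        rw [Submodule.mem_comap, hΛ j hjU] at this
        exact hjp this
      · intro htop
        simp only [Option.elim] at htop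
        have : Pi.single j0 1 ∈ LinearMap.ker (LinearMap.proj (R := K) (φ := fun _ : Fin m => K) j0) := by
          rw [htop]; exact Submodule.mem_top
        simp at this)
    have hcj0 : c1 j0 ≠ 0 := by
      have := hc1 none (Or.inr rfl)
      simpa using this
    have hcP : ∀ p ∈ Ps, Λ c1 ∉ p := fun p hp => hc1 (some p) (Or.inl ⟨p, hp, rfl⟩)
    have hΛc : Λ c1 = ∑ j, c1 j • (if j ∈ U then 0 else F j) := Fintype.linearCombination_apply _ _ _
    refine ⟨insert j0 U, Fin.cons (Λ c1) G, Fin.cons (F j0).totalDegree e, ?_, ?_, ?_, ?_, ?_, ?_⟩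
    · exact fun i => Fin.cases (hF j0) he i
    · refine fun i => Fin.cases ?_ hGe i
      simp only [Fin.cons_zero]
      rw [hΛc]
      refine totalDegree_finsetSum_le fun j _ => (totalDegree_smul_le _ _).trans ?_
      split_ifs with hj
      · simp
      · exact hmax j (by simpa using hj)
    · rw [Fin.prod_univ_succ, Finset.prod_insert hj0U]
      simp [hprod]
    · intro x hx i
      refine Fin.cases ?_ (hG0 x hx) i
      simp only [Fin.cons_zero]
      rw [hΛc, map_sum]
      refine Finset.sum_eq_zero fun j _ => ?_
      rw [smul_eval]
      split_ifs
      · simp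
      · rw [hS0 x hx, mul_zero]
    · intro p hp hpU
      have hp0 : Λ c1 ∈ p := hp 0
      refine hspan p (fun i => hp i.succ) fun i hi => ?_
      by_cases hij : i = j0
      · subst hij
        rw [hΛc, ← Finset.add_sum_erase _ _ (Finset.mem_univ i), if_neg hi] at hp0
        have h1 : ∑ j ∈ Finset.univ.erase i, c1 j • (if j ∈ U then 0 else F j) ∈ p := by
          refine p.sum_mem fun j hj => ?_
          rw [smul_eq_C_mul]
          refine p.mul_mem_left _ ?_
          split_ifs with hjU
          · exact p.zero_mem
          · exact hpU j (by simp [hjU, (Finset.mem_erase.1 hj).1])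
        have h2 := p.mul_mem_left (C (c1 i)⁻¹) ((p.add_mem_iff_left h1).1 hp0)
        rwa [smul_eq_C_mul, ← mul_assoc, ← C_mul, inv_mul_cancel₀ hcj0, C_1, one_mul] at h2
      · exact hpU i (by simp [hi, hij])
    · intro x hx p hp hpx hGp
      have hIp : I ≤ p := by
        rw [Ideal.span_le]
        rintro _ ⟨i, rfl⟩
        exact hGp i.succ
      obtain ⟨r, hr, hrp⟩ := Ideal.exists_minimalPrimes_le hIp
      have hrprime : r.IsPrime := hr.1.1
      have hlt : r < p := by
        refine lt_of_le_of_ne hrp ?_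
        rintro rfl
        exact hcP r ⟨hr, x, hx, hpx⟩ (hGp 0)
      have h1 := hht x hx r hrprime (hrp.trans hpx) fun i => hr.1.2 (Ideal.subset_span ⟨i, rfl⟩)
      have h2 := Ideal.height_add_one_le_of_lt_of_isPrime hlt
      push_cast
      exact (add_le_add_left h1 1).trans h2

lemma bezout_main {K : Type*} [Field K] [IsAlgClosed K] {n m : ℕ}
    (F : Fin m → MvPolynomial (Fin n) K) (hF : ∀ i, 0 < (F i).totalDegree)
    (S : Finset (Fin n → K)) (hS0 : ∀ x ∈ S, ∀ i, eval x (F i) = 0)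
    (hS : ∀ x ∈ S, ∀ p : Ideal (MvPolynomial (Fin n) K), p.IsPrime → p ≤ mI x →
      (∀ i, F i ∈ p) → p = mI x) : S.card ≤ ∏ i, (F i).totalDegree := by
  classical
  rcases S.eq_empty_or_nonempty with rfl | hne
  · simp
  rcases n with _ | n
  · have h1 : S.card ≤ 1 := Finset.card_le_one.2 fun a _ b _ => Subsingleton.elim a b
    exact h1.trans (Finset.prod_pos fun i _ => hF i)
  obtain ⟨U, G, e, he, hGe, hprod, hG0, -, hht⟩ := reduce F hF S hne hS0 hS (n + 1) le_rfl
  have h1 : S.card ≤ ∏ i, e i := by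
    refine square n G e he hGe S hG0 fun x hx p hp hpx hGp => ?_
    by_contra hpne
    have h2 := Ideal.height_add_one_le_of_lt_of_isPrime (lt_of_le_of_ne hpx hpne)
    have h3 := (add_le_add_left (hht x hx p hp hpx hGp) 1).trans h2
    rw [height_mI] at h3
    have h4 : n + 1 + 1 ≤ n + 1 := by exact_mod_cast h3
    omega
  rw [hprod] at h1
  exact h1.trans (Finset.prod_le_prod_of_subset_of_one_le' (Finset.subset_univ _)
    fun i _ _ => hF i)

end WB

/-- Affine weak Bézout theorem: over an algebraically closed field, the set of isolated
points of the zero set `V(F₁,…,F_m) ⊆ K^n` of nonconstant polynomials is finite of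
cardinality at most the product of the degrees.  (A point `x` of `V` is isolated iff some
Zariski-basic open set meets `V` exactly in `x`, i.e. there is a polynomial `g` with
`g(x) ≠ 0` and `g` vanishing at no other point of `V` than possibly... precisely:
`V ∩ {g ≠ 0} = {x}`.) -/
theorem stmt_7 (K : Type*) [Field K] [IsAlgClosed K] (n m : ℕ)
    (F : Fin m → MvPolynomial (Fin n) K) (hF : ∀ i, 0 < (F i).totalDegree) :
    let V : Set (Fin n → K) := {x | ∀ i, eval x (F i) = 0}
    let Iso : Set (Fin n → K) :=
      {x | x ∈ V ∧ ∃ g : MvPolynomial (Fin n) K, eval x g ≠ 0 ∧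
        ∀ y ∈ V, eval y g ≠ 0 → y = x}
    Iso.Finite ∧ Iso.ncard ≤ ∏ i, (F i).totalDegree := by
  intro V Iso
  have key : ∀ S : Finset (Fin n → K), (S : Set (Fin n → K)) ⊆ Iso →
      S.card ≤ ∏ i, (F i).totalDegree := by
    intro S hSI
    refine WB.bezout_main F hF S (fun x hx => (hSI hx).1) fun x hx p hp hpx hFp => ?_
    obtain ⟨-, g, hg, hiso⟩ := hSI hx
    exact WB.isolated_prime hg hiso p hpx hFp
  have hfin : Iso.Finite := by
    by_contra hinf
    obtain ⟨t, ht, hcard⟩ := Set.Infinite.exists_subset_card_eq hinf ((∏ i, (F i).totalDegree) + 1)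
    have := key t ht
    omega
  refine ⟨hfin, ?_⟩
  rw [Set.ncard_eq_toFinset_card _ hfin]
  exact key _ (by simp)
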